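/- There exists a finite colouring μ of the positive rationals ℚ⁺ (a function μ : ℚ⁺ → Fin r for some r ∈ ℕ) with the following property: for every bounded injective sequence (x_n)_{n≥1} of positive rationals such that the set {x_n + x_m, x_n · x_m : n ≠ m} is monochromatic under μ, and for every k ∈ ℕ, there exists n such that the denominator (in lowest terms) of x_n is divisible by some prime greater than the k-th prime p_k. Equivalently, the set of primes dividing the denominators of the terms of any such sequence is infinite. -/

import Mathlib

open Filter Topology

/-- `k` is the largest exponent of a prime in the denominator of `y`, attained at `p`. -/
def HasExp (p k : ℕ) (y : ℚ) : Prop :=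
  p.Prime ∧ padicValRat p y = -(k : ℤ) ∧ ∀ q : ℕ, q.Prime → -(k : ℤ) ≤ padicValRat q y

open Classical in
noncomputable def maxExp (y : ℚ) : ℕ :=
  if h : ∃ k p, HasExp p k y then h.choose else 0

lemma maxExp_eq {p k : ℕ} {y : ℚ} (h : HasExp p k y) : maxExp y = k := by
  have h' : ∃ k p, HasExp p k y := ⟨k, p, h⟩
  obtain ⟨q, hq⟩ := h'.choose_spec
  have e : maxExp y = h'.choose := by
    unfold maxExp
    rw [dif_pos h']
  rw [e]
  generalize h'.choose = l at hq
  have h1 := h.2.2 q hq.1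
  have h2 := hq.2.2 p h.1
  rw [hq.2.1] at h1
  rw [h.2.1] at h2
  omega

lemma HasExp.mul {p k l : ℕ} {x y : ℚ} (hx : x ≠ 0) (hy : y ≠ 0)
    (h1 : HasExp p k x) (h2 : HasExp p l y) : HasExp p (k + l) (x * y) := by
  refine ⟨h1.1, ?_, fun q hq => ?_⟩
  · have := Fact.mk h1.1
    rw [padicValRat.mul hx hy, h1.2.1, h2.2.1]
    push_cast; ring
  · have := Fact.mk hq
    rw [padicValRat.mul hx hy]
    have := h1.2.2 q hq
    have := h2.2.2 q hq
    push_cast; linarith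

lemma HasExp.add {p k l : ℕ} {x y : ℚ} (hx : 0 < x) (hy : 0 < y) (hkl : k < l)
    (h1 : HasExp p k x) (h2 : HasExp p l y) : HasExp p l (x + y) := by
  have hxy : x + y ≠ 0 := by positivity
  refine ⟨h1.1, ?_, fun q hq => ?_⟩
  · have := Fact.mk h1.1
    rw [add_comm, padicValRat.add_eq_of_lt (by rwa [add_comm]) hy.ne' hx.ne', h2.2.1]
    rw [h1.2.1, h2.2.1]; omega
  · have := Fact.mk hq
    have := padicValRat.min_le_padicValRat_add (p := q) hxy
    have := h1.2.2 q hq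
    have := h2.2.2 q hq
    have : -(l : ℤ) ≤ min (padicValRat q x) (padicValRat q y) := by
      apply le_min <;> omega
    omega

lemma padicValRat_of_dvd_den {p : ℕ} (hp : p.Prime) {y : ℚ} (h : p ∣ y.den) :
    padicValRat p y = -(padicValNat p y.den : ℤ) := by
  rw [padicValRat]
  have : padicValInt p y.num = 0 := by
    rw [padicValInt]
    apply padicValNat.eq_zero_of_not_dvd
    intro h'
    have := Nat.dvd_gcd h' h
    rw [y.reduced] at this
    exact hp.one_lt.ne' (Nat.dvd_one.mp this)
  simp [this]

lemma exists_hasExp {y : ℚ} (hy : y.den ≠ 1) : ∃ p k, p ∣ y.den ∧ HasExp p k y := by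
  obtain ⟨p, hp, hmax⟩ := Finset.exists_max_image y.den.primeFactors
    (fun p => padicValNat p y.den)
    (by rw [Nat.nonempty_primeFactors]; have := y.den_pos; omega)
  have hp' := Nat.prime_of_mem_primeFactors hp
  have hd := Nat.dvd_of_mem_primeFactors hp
  refine ⟨p, padicValNat p y.den, hd, hp', padicValRat_of_dvd_den hp' hd, fun q hq => ?_⟩
  by_cases hqd : q ∣ y.den
  · rw [padicValRat_of_dvd_den hq hqd]
    have := hmax q (Nat.mem_primeFactors.mpr ⟨hq, hqd, y.den_ne_zero⟩)
    omega
  · rw [padicValRat, padicValNat.eq_zero_of_not_dvd hqd]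
    omega

lemma den_dvd {N K p k : ℕ} {y : ℚ} (h : HasExp p k y) (hk : k ≤ K)
    (hN : ∀ q : ℕ, q.Prime → q ∣ y.den → q ≤ N) : y.den ∣ (N.factorial) ^ K := by
  rw [← Nat.factorization_prime_le_iff_dvd y.den_ne_zero
    (pow_ne_zero _ (Nat.factorial_ne_zero N))]
  intro q hq
  by_cases hqd : q ∣ y.den
  · have h1 := h.2.2 q hq
    rw [padicValRat_of_dvd_den hq hqd] at h1
    have h2 : 1 ≤ (N.factorial).factorization q :=
      (hq.dvd_iff_one_le_factorization (Nat.factorial_ne_zero N)).mp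
        ((hq.dvd_factorial).mpr (hN q hq hqd))
    rw [Nat.factorization_pow, Nat.factorization_def _ hq]
    simp only [Finsupp.smul_apply, smul_eq_mul]
    have h3 : padicValNat q y.den ≤ k := by omega
    nlinarith
  · rw [Nat.factorization_eq_zero_of_not_dvd hqd]
    exact Nat.zero_le _

lemma pigeon {α : Type*} [Finite α] (f : ℕ → α) :
    ∃ c, ∃ φ : ℕ → ℕ, StrictMono φ ∧ ∀ n, f (φ n) = c := by
  obtain ⟨c, hc⟩ := Finite.exists_infinite_fiber f
  have : (f ⁻¹' {c}).Infinite := Set.infinite_coe_iff.mp hc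
  obtain ⟨φ, h1, h2⟩ := Filter.extraction_of_frequently_atTop
    (Nat.frequently_atTop_iff_infinite.mpr this)
  exact ⟨c, φ, h1, h2⟩

noncomputable def ff (y : ℝ) : ℝ := 2 * Real.logb 2 |Real.log (y / 4)|

lemma ff_cont {a : ℝ} (ha : 0 < a) (ha4 : a ≠ 4) : ContinuousAt ff a := by
  have h0 : a / 4 ≠ 0 := by positivity
  have h1 : Real.log (a / 4) ≠ 0 := by
    rw [Real.log_ne_zero]
    refine ⟨h0, ?_, ?_⟩
    · intro h; apply ha4; linarith
    · intro h; linarith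
  unfold ff Real.logb
  have : ContinuousAt (fun y : ℝ => |Real.log (y / 4)|) a :=
    ((continuousAt_id.div_const 4).log h0).abs
  exact ((this.log (abs_ne_zero.mpr h1)).div_const _).const_mul 2

noncomputable def col (y : ℚ) : ZMod 4 × ZMod 2 × Prop :=
  (((⌊ff (y : ℝ)⌋ : ℤ) : ZMod 4), (padicValNat 2 (maxExp y) : ZMod 2),
    1 / y < (padicValNat 2 (maxExp y) : ℚ))

lemma col_ne {u w : ℚ} (h1 : 1 < ff w - ff u) (h2 : ff w - ff u < 3) : col u ≠ col w := by
  intro h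
  have h := congrArg Prod.fst h
  simp only [col] at h
  rw [ZMod.intCast_eq_intCast_iff_dvd_sub] at h
  have a1 := Int.floor_le (ff w)
  have a2 := Int.lt_floor_add_one (ff w)
  have a3 := Int.floor_le (ff u)
  have a4 := Int.lt_floor_add_one (ff u)
  have b1 : ((⌊ff w⌋ - ⌊ff u⌋ : ℤ) : ℝ) < (4 : ℤ) := by push_cast; linarith
  have b2 : ((0 : ℤ) : ℝ) < ((⌊ff w⌋ - ⌊ff u⌋ : ℤ) : ℝ) := by push_cast; linarith
  rw [Int.cast_lt] at b1 b2
  push_cast at h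
  omega

lemma exists_ne_col {u w : ℕ → ℚ} {a b : ℝ} (ha : 0 < a) (hb : 0 < b) (ha4 : a ≠ 4) (hb4 : b ≠ 4)
    (hu : Tendsto (fun n => (u n : ℝ)) atTop (𝓝 a)) (hw : Tendsto (fun n => (w n : ℝ)) atTop (𝓝 b))
    (h1 : 1 < ff b - ff a) (h2 : ff b - ff a < 3) : ∀ᶠ n in atTop, col (u n) ≠ col (w n) := by
  have := ((ff_cont hb hb4).tendsto.comp hw).sub ((ff_cont ha ha4).tendsto.comp hu)
  filter_upwards [this.eventually (lt_mem_nhds h1), this.eventually (gt_mem_nhds h2)] with n p1 p2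
  exact col_ne p1 p2

lemma ff_sub {a b : ℝ} (ha : Real.log (a / 4) ≠ 0) (hb : Real.log (b / 4) ≠ 0) :
    ff b - ff a = 2 * Real.logb 2 (|Real.log (b / 4) / Real.log (a / 4)|) := by
  unfold ff
  rw [abs_div, Real.logb_div (abs_ne_zero.mpr hb) (abs_ne_zero.mpr ha)]
  ring

lemma log_ne {a : ℝ} (ha : 0 < a) (ha4 : a ≠ 4) : Real.log (a / 4) ≠ 0 := by
  rw [Real.log_ne_zero]
  refine ⟨by positivity, ?_, ?_⟩
  · intro h; apply ha4; linarith
  · intro h; linarith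

/-- limit positive, not two -/
lemma caseA {x : ℕ → ℚ} {L : ℝ} (hL : 0 < L) (hL2 : L ≠ 2)
    (hx : Tendsto (fun n => (x n : ℝ)) atTop (𝓝 L)) :
    ∃ n m, n ≠ m ∧ col (x n + x m) ≠ col (x n * x m) := by
  have hx1 := hx.comp (tendsto_add_atTop_nat 1)
  have a4 : L + L ≠ 4 := by intro h; apply hL2; linarith
  have b4 : L * L ≠ 4 := by
    intro h
    have : (L - 2) * (L + 2) = 0 := by linarith
    rcases mul_eq_zero.mp this with h | h
    · apply hL2; linarith
    · linarith
  have key : ff (L * L) - ff (L + L) = 2 := by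
    have ha := log_ne (a := L + L) (by positivity) a4
    have hb := log_ne (a := L * L) (by positivity) b4
    rw [ff_sub ha hb]
    have : Real.log (L * L / 4) = 2 * Real.log ((L + L) / 4) := by
      rw [show L * L / 4 = ((L + L) / 4) ^ 2 by ring, Real.log_pow]; norm_num
    rw [this, mul_div_assoc, div_self ha]
    norm_num
  have := exists_ne_col (u := fun n => x n + x (n + 1)) (w := fun n => x n * x (n + 1))
    (a := L + L) (b := L * L) (by positivity) (by positivity) a4 b4
    (by simpa using hx.add hx1) (by simpa using hx.mul hx1) (by rw [key]; norm_num)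
    (by rw [key]; norm_num)
  obtain ⟨n, hn⟩ := this.exists
  exact ⟨n, n + 1, by omega, hn⟩

lemma slope_log (c : ℝ) : Tendsto (fun t : ℝ => Real.log (1 + c * t) / t) (𝓝[≠] 0) (𝓝 c) := by
  have h : HasDerivAt (fun t : ℝ => Real.log (1 + c * t)) c 0 := by
    have h1 : HasDerivAt (fun t : ℝ => 1 + c * t) c 0 := by
      simpa using ((hasDerivAt_id (0 : ℝ)).const_mul c).const_add 1
    simpa using h1.log (by simp)
  have := h.tendsto_slope_zero
  refine this.congr fun t => ?_
  simp [div_eq_inv_mul]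

/-- limit two -/
lemma caseB {x : ℕ → ℚ} (hinj : Function.Injective x) (hpos : ∀ n, 0 < x n)
    (hx : Tendsto (fun n => (x n : ℝ)) atTop (𝓝 2)) :
    ∃ n m, n ≠ m ∧ col (x n + x m) ≠ col (x n * x m) := by
  have hne : ∀ᶠ n in atTop, x n ≠ 2 := by
    have := hinj.tendsto_cofinite.eventually (Set.finite_singleton (2 : ℚ)).compl_mem_cofinite
    rw [Nat.cofinite_eq_atTop] at this
    exact this
  have ht : Tendsto (fun n => (x n : ℝ) - 2) atTop (𝓝[≠] 0) := by
    rw [tendsto_nhdsWithin_iff]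
    refine ⟨by simpa using hx.sub_const 2, ?_⟩
    filter_upwards [hne] with n hn
    simp only [Set.mem_compl_iff, Set.mem_singleton_iff]
    intro h
    apply hn
    have : (x n : ℝ) = 2 := by linarith
    exact_mod_cast this
  have hr := ((slope_log (1/2)).div (slope_log (1/4)) (by norm_num)).comp ht
  have hr2 : Tendsto (fun r : ℝ => 2 * Real.logb 2 |r|) (𝓝 (1/2/(1/4))) (𝓝 2) := by
    have : ContinuousAt (fun r : ℝ => 2 * Real.logb 2 |r|) (1/2/(1/4)) := by
      unfold Real.logb
      exact ((continuousAt_id.abs.log (by norm_num)).div_const _).const_mul 2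
    have h := this.tendsto
    have e : (2 * Real.logb 2 |(1/2/(1/4) : ℝ)|) = 2 := by
      rw [show (1/2/(1/4) : ℝ) = 2 by norm_num]; simp
    rwa [e] at h
  have hr3 := hr2.comp hr
  obtain ⟨n, hn, h1, h2⟩ := (hne.and ((hr3.eventually (lt_mem_nhds (show (1:ℝ) < 2 by norm_num))).and
    (hr3.eventually (gt_mem_nhds (show (2:ℝ) < 3 by norm_num))))).exists
  have hp : (0 : ℝ) < x n := by exact_mod_cast hpos n
  have hn' : (x n : ℝ) ≠ 2 := by exact_mod_cast hn
  have ht0 : (x n : ℝ) - 2 ≠ 0 := sub_ne_zero.mpr hn'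
  have a4 : (x n : ℝ) + 2 ≠ 4 := by intro h; apply hn'; linarith
  have b4 : (x n : ℝ) * 2 ≠ 4 := by intro h; apply hn'; linarith
  have e : ff ((x n : ℝ) * 2) - ff ((x n : ℝ) + 2) =
      2 * Real.logb 2 |Real.log (1 + 1/2 * ((x n : ℝ) - 2)) / ((x n : ℝ) - 2) /
        (Real.log (1 + 1/4 * ((x n : ℝ) - 2)) / ((x n : ℝ) - 2))| := by
    rw [ff_sub (log_ne (by positivity) a4) (log_ne (by positivity) b4)]
    rw [div_div_div_cancel_right₀ ht0]
    congr 5 <;> ring_nf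
  simp only [Function.comp, Pi.div_apply] at h1 h2
  rw [← e] at h1 h2
  have := exists_ne_col (u := fun m => x n + x m) (w := fun m => x n * x m)
    (a := x n + 2) (b := x n * 2) (by positivity) (by positivity) a4 b4
    (by simpa using hx.const_add (x n : ℝ)) (by simpa using hx.const_mul (x n : ℝ)) h1 h2
  obtain ⟨m, hm, hm'⟩ := (this.and (eventually_gt_atTop n)).exists
  exact ⟨n, m, by omega, hm⟩

lemma val_add_high {a b v : ℕ} (ha : a ≠ 0) (hv : padicValNat 2 a = v) (hb : 2 ^ (v + 1) ∣ b) :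
    padicValNat 2 (a + b) = v := by
  have h1 : 2 ^ v ∣ a := hv ▸ pow_padicValNat_dvd
  have h2 : ¬ 2 ^ (v + 1) ∣ a := hv ▸ pow_succ_padicValNat_not_dvd ha
  have hab : a + b ≠ 0 := by omega
  apply le_antisymm
  · by_contra! h
    have : 2 ^ (v + 1) ∣ a + b := (padicValNat_dvd_iff_le hab).mpr h
    exact h2 ((Nat.dvd_add_left hb).mp this)
  · exact (padicValNat_dvd_iff_le hab).mp (dvd_add h1 ((pow_dvd_pow 2 (by omega)).trans hb))

/-- limit zero -/
lemma caseC' {x : ℕ → ℚ} {p : ℕ} {e : ℕ → ℕ} (hpos : ∀ n, 0 < x n)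
    (hx : Tendsto (fun n => (x n : ℝ)) atTop (𝓝 0))
    (he : ∀ n, HasExp p (e n) (x n)) (het : Tendsto e atTop atTop) :
    ∃ n m, n ≠ m ∧ ∃ n' m', n' ≠ m' ∧ col (x n + x m) ≠ col (x n' * x m') := by
  have hsum : ∀ n m, e n < e m → maxExp (x n + x m) = e m := fun n m h =>
    maxExp_eq ((he n).add (hpos n) (hpos m) h (he m))
  have hprod : ∀ n m, maxExp (x n * x m) = e n + e m := fun n m =>
    maxExp_eq ((he n).mul (hpos n).ne' (hpos m).ne' (he m))
  by_cases hb : ∃ K, ∃ᶠ n in atTop, padicValNat 2 (e n) ≤ K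
  · obtain ⟨K, hK⟩ := hb
    have hK' := hK.and_eventually (het.eventually_gt_atTop 0)
    obtain ⟨φ, hφ, hφK⟩ := Filter.extraction_of_frequently_atTop hK'
    obtain ⟨c, ψ, hψ, hc⟩ := pigeon (fun n => (e (φ n) : ZMod (2 ^ (K + 2))))
    have ht := het.comp (hφ.comp hψ).tendsto_atTop
    obtain ⟨j, hj, hj0⟩ := ((ht.eventually_gt_atTop (e (φ (ψ 0)))).and
      (eventually_gt_atTop 0)).exists
    simp only [Function.comp] at hj
    set n := φ (ψ 0) with hn
    set m := φ (ψ j) with hm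
    have hnm : n ≠ m := by intro h; rw [h] at hj; omega
    obtain ⟨hnK, hn0⟩ : padicValNat 2 (e n) ≤ K ∧ 0 < e n := hφK (ψ 0)
    have hcc := (hc 0).trans (hc j).symm
    rw [ZMod.natCast_eq_natCast_iff, Nat.modEq_iff_dvd' hj.le] at hcc
    obtain ⟨t, ht⟩ := hcc
    have v1 : padicValNat 2 (e m) = padicValNat 2 (e n) := by
      rw [show e m = e n + 2 ^ (K + 2) * t by omega]
      exact val_add_high hn0.ne' rfl (Dvd.dvd.mul_right (pow_dvd_pow 2 (by omega)) _)
    have v2 : padicValNat 2 (e n + e m) = padicValNat 2 (e n) + 1 := by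
      rw [show e n + e m = 2 * e n + 2 ^ (K + 2) * t by omega]
      refine val_add_high (by omega) ?_ (Dvd.dvd.mul_right (pow_dvd_pow 2 (by omega)) _)
      rw [padicValNat.mul (by norm_num) hn0.ne']
      simp [add_comm]
    refine ⟨n, m, hnm, n, m, hnm, fun h => ?_⟩
    have h := congrArg (fun z => z.2.1) h
    simp only [col, hsum n m hj, hprod, v1, v2] at h
    simp at h
  · push Not at hb
    have hv0 : ∃ n, 0 < e n := (het.eventually_gt_atTop 0).exists
    obtain ⟨n, hn⟩ := hv0
    have E1 : ∀ᶠ m in atTop, (x m : ℝ) * (x n * (padicValNat 2 (e n) : ℝ)) < 1 := by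
      have := hx.mul_const ((x n : ℝ) * (padicValNat 2 (e n) : ℝ))
      rw [zero_mul] at this
      exact this.eventually (gt_mem_nhds one_pos)
    obtain ⟨k, hk⟩ := exists_nat_gt (1 / x n)
    obtain ⟨m, m1, m2, m3, m4⟩ := (E1.and ((hb k).and ((hb (padicValNat 2 (e n))).and
      (het.eventually_gt_atTop (e n))))).exists
    have hnm : n ≠ m := by intro h; rw [h] at m4; omega
    refine ⟨n, m, hnm, n, m, hnm, fun h => ?_⟩
    have h := congrArg (fun z => z.2.2) h
    have v2 : padicValNat 2 (e n + e m) = padicValNat 2 (e n) :=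
      val_add_high hn.ne' rfl ((pow_dvd_pow 2 (by omega)).trans pow_padicValNat_dvd)
    simp only [col, hsum n m m4, hprod, v2] at h
    have xn := hpos n
    have xm := hpos m
    have h1 : 1 / (x n + x m) < (padicValNat 2 (e m) : ℚ) := by
      have : 1 / (x n + x m) ≤ 1 / x n := by gcongr; linarith
      have : (k : ℚ) < (padicValNat 2 (e m) : ℚ) := by exact_mod_cast m2
      linarith
    rw [h] at h1
    have m1' : x m * (x n * (padicValNat 2 (e n) : ℚ)) < 1 := by exact_mod_cast m1
    rw [div_lt_iff₀ (by positivity)] at h1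
    linarith

lemma caseC {x : ℕ → ℚ} {N : ℕ} (hpos : ∀ n, 0 < x n)
    (hx : Tendsto (fun n => (x n : ℝ)) atTop (𝓝 0))
    (hN : ∀ n, ∀ q : ℕ, q.Prime → q ∣ (x n).den → q ≤ N) :
    ∃ n m, n ≠ m ∧ ∃ n' m', n' ≠ m' ∧ col (x n + x m) ≠ col (x n' * x m') := by
  have low : ∀ n, (1 : ℝ) ≤ x n * (x n).den := by
    intro n
    have h1 : x n * (x n).den = (x n).num := Rat.mul_den_eq_num _
    have h2 : (1 : ℤ) ≤ (x n).num := Rat.num_pos.mpr (hpos n)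
    have h3 : (1 : ℚ) ≤ x n * (x n).den := by rw [h1]; exact_mod_cast h2
    exact_mod_cast h3
  have big : ∀ M : ℕ, ∀ᶠ n in atTop, M < (x n).den := by
    intro M
    have := hx.mul_const (M : ℝ)
    rw [zero_mul] at this
    filter_upwards [this.eventually (gt_mem_nhds one_pos)] with n hn
    by_contra! h
    have h' : ((x n).den : ℝ) ≤ M := by exact_mod_cast h
    have hp : (0 : ℝ) < x n := by exact_mod_cast hpos n
    have := low n
    nlinarith
  obtain ⟨n0, hn0⟩ := eventually_atTop.mp (big 1)
  have hex : ∀ n, ∃ p k, p ∣ (x (n + n0)).den ∧ HasExp p k (x (n + n0)) := fun n =>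
    exists_hasExp (hn0 (n + n0) (by omega)).ne'
  choose P e hPd hPe using hex
  have hPN : ∀ n, P n < N + 1 := fun n =>
    Nat.lt_succ_of_le (hN _ _ (hPe n).1 (hPd n))
  obtain ⟨c, φ, hφ, hc⟩ := pigeon (fun n => (⟨P n, hPN n⟩ : Fin (N + 1)))
  have het : Tendsto e atTop atTop := by
    rw [tendsto_atTop]
    intro K
    have := (tendsto_add_atTop_nat n0).eventually (big (N.factorial ^ K))
    filter_upwards [this] with n hn
    by_contra! h
    have := Nat.le_of_dvd (by positivity) (den_dvd (hPe n) h.le (hN _))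
    omega
  have hθ : StrictMono (fun n => φ n + n0) := fun a b h => by
    have := hφ h
    simp only; omega
  obtain ⟨n, m, hnm, n', m', hnm', h⟩ := caseC' (x := fun n => x (φ n + n0)) (p := c)
    (e := fun n => e (φ n)) (fun n => hpos _) (hx.comp hθ.tendsto_atTop)
    (fun n => by
      have h1 := hPe (φ n)
      have h2 := congrArg Fin.val (hc n)
      simp only at h2
      rwa [h2] at h1) (het.comp hφ.tendsto_atTop)
  exact ⟨_, _, hθ.injective.ne hnm, _, _, hθ.injective.ne hnm', h⟩

/-- There exists a finite colouring `μ` of the positive rationals such that for every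
bounded injective sequence `(x_n)` of positive rationals with
`{x_n + x_m, x_n * x_m : n ≠ m}` monochromatic, and for every `k`, some term `x_n` has a
prime greater than the `k`-th prime dividing its denominator (equivalently, the set of
primes dividing the denominators of the terms is infinite). -/
theorem stmt_7 :
    ∃ (r : ℕ) (μ : ℚ → Fin r),
      ∀ (x : ℕ → ℚ),
        Function.Injective x → (∀ n, 0 < x n) → (∃ C : ℚ, ∀ n, x n ≤ C) →
        (∃ c : Fin r, ∀ n m, n ≠ m → μ (x n + x m) = c ∧ μ (x n * x m) = c) →
        ∀ k : ℕ, ∃ (n : ℕ) (p : ℕ), p.Prime ∧ p ∣ (x n).den ∧ Nat.nth Nat.Prime k < p := by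
  let E := Finite.equivFin (ZMod 4 × ZMod 2 × Prop)
  refine ⟨_, fun y => E (col y), ?_⟩
  rintro x hinj hpos ⟨C, hC⟩ ⟨c, hc⟩ k
  by_contra! hN
  have hmono : ∀ n m, n ≠ m → ∀ n' m', n' ≠ m' → col (x n + x m) = col (x n' * x m') :=
    fun n m h n' m' h' => E.injective ((hc n m h).1.trans (hc n' m' h').2.symm)
  obtain ⟨L, hL, φ, hφ, hx⟩ := (isCompact_Icc (a := (0 : ℝ)) (b := (C : ℝ))).tendsto_subseq
    (x := fun n => (x n : ℝ))
    (fun n => ⟨by exact_mod_cast (hpos n).le, by exact_mod_cast hC n⟩)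
  have hx' : Tendsto (fun n => ((x ∘ φ) n : ℝ)) atTop (𝓝 L) := hx
  have hpos' : ∀ n, 0 < (x ∘ φ) n := fun n => hpos _
  rcases hL.1.eq_or_lt with h0 | h0
  · subst h0
    obtain ⟨n, m, h, n', m', h', hh⟩ := caseC (N := Nat.nth Nat.Prime k) hpos' hx'
      (fun n q hq hd => hN _ q hq hd)
    exact hh (hmono _ _ (hφ.injective.ne h) _ _ (hφ.injective.ne h'))
  · by_cases h2 : L = 2
    · subst h2
      obtain ⟨n, m, h, hh⟩ := caseB (hinj.comp hφ.injective) hpos' hx'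
      exact hh (hmono _ _ (hφ.injective.ne h) _ _ (hφ.injective.ne h))
    · obtain ⟨n, m, h, hh⟩ := caseA h0 h2 hx'
      exact hh (hmono _ _ (hφ.injective.ne h) _ _ (hφ.injective.ne h))
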